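/- A strongly connected tournament is triangle-connected if and only if it has no nontrivial homogeneous set that contains a cyclic triangle. -/

import Mathlib

/-- A tournament on a vertex type `V`: for any two distinct vertices exactly one of the
two possible directed edges is present. -/
structure Tournament (V : Type) where
  rel : V → V → Prop
  asymm : ∀ u v, rel u v → ¬ rel v u
  total : ∀ u v, u ≠ v → rel u v ∨ rel v u

namespace Tournament

variable {V : Type}

/-- `X` is a homogeneous set of the subtournament of `T` induced on `S`. -/
def HomogOn (T : Tournament V) (S X : Set V) : Prop :=
  X ⊆ S ∧ ∀ v ∈ S \ X, (∀ x ∈ X, T.rel v x) ∨ (∀ x ∈ X, T.rel x v)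

/-- The subtournament of `T` induced on `S` is prime: it is a (nonempty) tournament all
of whose homogeneous sets are trivial. -/
def PrimeOn (T : Tournament V) (S : Set V) : Prop :=
  S.Nonempty ∧ ∀ X : Set V, T.HomogOn S X → X.ncard ≤ 1 ∨ X = S

/-- The subtournament of `T` induced on `S` is isomorphic to the tournament on `Fin n`
with edge relation `r`. -/
def IsoOnFin (T : Tournament V) (S : Set V) {n : ℕ} (r : Fin n → Fin n → Prop) : Prop :=
  ∃ f : Fin n → V, Function.Injective f ∧ Set.range f = S ∧
    ∀ i j : Fin n, r i j ↔ T.rel (f i) (f j)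

/-- `T` has a subtournament isomorphic to the tournament on `Fin n` with edge relation `r`. -/
def HasSub (T : Tournament V) {n : ℕ} (r : Fin n → Fin n → Prop) : Prop :=
  ∃ f : Fin n → V, Function.Injective f ∧ ∀ i j : Fin n, r i j ↔ T.rel (f i) (f j)

/-- The subtournament of `T` induced on `S` has a subtournament isomorphic to the
tournament on `Fin n` with edge relation `r`. -/
def HasSubIn (T : Tournament V) (S : Set V) {n : ℕ} (r : Fin n → Fin n → Prop) : Prop :=
  ∃ f : Fin n → V, Function.Injective f ∧ (∀ i, f i ∈ S) ∧
    ∀ i j : Fin n, r i j ↔ T.rel (f i) (f j)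

/-- `v ∈ Ext(H)`: `v` is outside `H` and `H + v` is prime. -/
def mem_Ext (T : Tournament V) (H : Set V) (v : V) : Prop :=
  v ∉ H ∧ T.PrimeOn (insert v H)

/-- `v ∈ Z(H)`: `v` is outside `H` and `H` is a homogeneous set of `H + v`. -/
def mem_Z (T : Tournament V) (H : Set V) (v : V) : Prop :=
  v ∉ H ∧ T.HomogOn (insert v H) H

/-- `v ∈ V_x(H)`: `v` is outside `H` and `{v, x}` is a homogeneous set of `H + v`. -/
def mem_Vx (T : Tournament V) (H : Set V) (x v : V) : Prop :=
  v ∉ H ∧ T.HomogOn (insert v H) {v, x}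

/-- `C` is (the vertex set of) a cyclic triangle of `T`. -/
def CycTri (T : Tournament V) (C : Set V) : Prop :=
  ∃ a b c : V, C = {a, b, c} ∧ T.rel a b ∧ T.rel b c ∧ T.rel c a

/-- The cyclic triangles `C` and `C'` are triangle-connected: there is a sequence of
cyclic triangles from `C` to `C'` in which consecutive triangles share exactly two
vertices. -/
def TriConn (T : Tournament V) (C C' : Set V) : Prop :=
  ∃ m : ℕ, ∃ f : Fin (m + 1) → Set V,
    f 0 = C ∧ f (Fin.last m) = C' ∧ (∀ i, T.CycTri (f i)) ∧
    ∀ i : Fin m, ((f i.castSucc) ∩ (f i.succ)).ncard = 2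

/-- `T` is strongly connected. -/
def StronglyConnected (T : Tournament V) : Prop :=
  ∀ u v : V, Relation.ReflTransGen T.rel u v

/-- The subtournament of `T` induced on `S` is a transitive tournament. -/
def TransOn (T : Tournament V) (S : Set V) : Prop :=
  ∃ m : ℕ, ∃ f : Fin m → V, Function.Injective f ∧ Set.range f = S ∧
    ∀ i j : Fin m, i < j → T.rel (f i) (f j)

end Tournament

/-- The tournament `T_n` (`n = 2k+1` odd) on `Fin n`: `i → j` iff `j - i mod n ∈ {1, …, k}`. -/
def TTrel (n : ℕ) (i j : Fin n) : Prop :=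
  1 ≤ (j.val + n - i.val) % n ∧ (j.val + n - i.val) % n ≤ n / 2

/-- The tournament `U_n`: obtained from `T_n` by reversing all edges with both ends among
the first `k` vertices. -/
def UUrel (n : ℕ) (i j : Fin n) : Prop :=
  if i.val < n / 2 ∧ j.val < n / 2 then TTrel n j i else TTrel n i j

/-- The tournament `W_n` on `Fin n` (vertex `n-1` plays the role of `w_n`). -/
def WWrel (n : ℕ) (i j : Fin n) : Prop :=
  (i.val < j.val ∧ j.val < n - 1) ∨ (j.val = n - 1 ∧ i.val < n - 1 ∧ i.val % 2 = 1) ∨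
    (i.val = n - 1 ∧ j.val < n - 1 ∧ j.val % 2 = 0)

/-- The tournament `P_n` on `Fin n`: `i → j` iff `j - i ≥ 2` or `i = j + 1`. -/
def PPrel (n : ℕ) (i j : Fin n) : Prop := i.val + 2 ≤ j.val ∨ i.val = j.val + 1

/-- The tournament `D_4`: vertex `0` beats the cyclic triangle `{1, 2, 3}`. -/
def DDrel (i j : Fin 4) : Prop :=
  (i = 0 ∧ j ≠ 0) ∨ (i = 1 ∧ j = 2) ∨ (i = 2 ∧ j = 3) ∨ (i = 3 ∧ j = 1)

/-- The tournament `J_n` on `Fin n`: the identity ordering has exactly one backedge,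
from the last vertex to the first. -/
def JJrel (n : ℕ) (i j : Fin n) : Prop :=
  (i.val < j.val ∧ ¬(i.val = 0 ∧ j.val = n - 1)) ∨ (i.val = n - 1 ∧ j.val = 0)

/-- The tournament `K_n` on `Fin n`: the identity ordering has exactly one backedge,
from the last vertex to the second. -/
def KKrel (n : ℕ) (i j : Fin n) : Prop :=
  (i.val < j.val ∧ ¬(i.val = 1 ∧ j.val = n - 1)) ∨ (i.val = n - 1 ∧ j.val = 1)

/-- The tournament `K_n^*` on `Fin n`: the identity ordering has exactly one backedge,
from the second-to-last vertex to the first. -/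
def KKsrel (n : ℕ) (i j : Fin n) : Prop :=
  (i.val < j.val ∧ ¬(i.val = 0 ∧ j.val = n - 2)) ∨ (i.val = n - 2 ∧ j.val = 0)

/-- `(j, i)` (0-indexed, `i < j`) is one of the backedges of the defining ordering of `Q_n`. -/
def Qback (n i j : ℕ) : Prop :=
  (j = n - 2 ∧ i = 0) ∨ (j = n - 1 ∧ i = n - 3) ∨ (j = i + 1 ∧ j ≤ n - 3)

/-- The tournament `Q_n` on `Fin n`. -/
def QQrel (n : ℕ) (i j : Fin n) : Prop :=
  (i.val < j.val ∧ ¬ Qback n i.val j.val) ∨ (j.val < i.val ∧ Qback n j.val i.val)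

/-- `e` is a matching ordering of the tournament with edge relation `r` on `V`:
`e` lists all vertices and every vertex is the head or tail of at most one backedge. -/
def MatchingOrd {V : Type} (r : V → V → Prop) {m : ℕ} (e : Fin m → V) : Prop :=
  Function.Bijective e ∧
    ∀ i : Fin m, {j : Fin m | (i < j ∧ r (e j) (e i)) ∨ (j < i ∧ r (e i) (e j))}.Subsingleton

/-- `e` is a matching ordering of the subtournament induced on `S`. -/
def MatchingOrdOn {V : Type} (r : V → V → Prop) (S : Set V) {m : ℕ} (e : Fin m → V) : Prop :=
  Set.BijOn e Set.univ S ∧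
    ∀ i : Fin m, {j : Fin m | (i < j ∧ r (e j) (e i)) ∨ (j < i ∧ r (e i) (e j))}.Subsingleton

/-- The subtournament induced on `S` is a matching tournament. -/
def IsMatchingOn {V : Type} (r : V → V → Prop) (S : Set V) : Prop :=
  ∃ m : ℕ, ∃ e : Fin m → V, MatchingOrdOn r S e

/-- The permutation `σ_X` of the interval of integers `X = {b, …, a}` (identity off `X`):
the cycle `(b b+2 … a-2 a a-1 a-3 … b+1)` when `|X|` is odd and
`(b b+2 … a-1 a a-2 … b+1)` when `|X|` is even. -/
def sigmaX (b a x : ℕ) : ℕ :=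
  if x < b ∨ a < x then x
  else if a = b then x
  else if (x - b) % 2 = 0 then
    (if x + 2 ≤ a then x + 2 else if x + 1 ≤ a then x + 1 else x - 1)
  else (if b + 3 ≤ x then x - 2 else b)

/-- The permutation `τ_X = (b b+2)(b+1 b+3)` of `X = {b, b+1, b+2, b+3}`. -/
def tauX (b x : ℕ) : ℕ :=
  if x = b then b + 2 else if x = b + 2 then b
  else if x = b + 1 then b + 3 else if x = b + 3 then b + 1 else x

/-- The permutation `π_1` of the interval `{b, …, a}`: product of the transpositions
swapping the 1st and 2nd, 3rd and 4th, … elements of the interval. -/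
def pi1N (b a x : ℕ) : ℕ :=
  if x < b ∨ a < x then x
  else if (x - b) % 2 = 0 then (if x + 1 ≤ a then x + 1 else x)
  else x - 1

/-- The permutation `π_2` of the interval `{b, …, a}`: product of the transpositions
swapping the 2nd and 3rd, 4th and 5th, … elements of the interval. -/
def pi2N (b a x : ℕ) : ℕ :=
  if x < b ∨ a < x then x
  else if x = b then x
  else if (x - b) % 2 = 1 then (if x + 1 ≤ a then x + 1 else x)
  else x - 1

/-- The segment of the ordering `e` on positions `b, …, a` induces a transitive tournament,
with ordering given (relative to the standard ordering `f`) by the permutation `p`. -/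
def SegTrans {V : Type} (T : Tournament V) {n : ℕ} (e : Fin n → V) (b a : ℕ) (p : ℕ → ℕ) : Prop :=
  ∃ f : ℕ → V, (∀ x y : ℕ, b ≤ x → x < y → y ≤ a → T.rel (f x) (f y)) ∧
    ∀ i : Fin n, b ≤ i.val → i.val ≤ a → e i = f (p i.val)

/-- The segment of the ordering `e` on positions `b, …, a` induces a tournament isomorphic
to `P_m` (where `m = a - b + 1`), with ordering given (relative to the defining ordering
`f` of `P_m`) by the permutation `p`. -/
def SegP {V : Type} (T : Tournament V) {n : ℕ} (e : Fin n → V) (b a : ℕ) (p : ℕ → ℕ) : Prop :=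
  ∃ f : ℕ → V,
    (∀ x y : ℕ, b ≤ x → x ≤ a → b ≤ y → y ≤ a →
      (T.rel (f x) (f y) ↔ (x + 2 ≤ y ∨ x = y + 1))) ∧
    ∀ i : Fin n, b ≤ i.val → i.val ≤ a → e i = f (p i.val)

namespace Tournament

variable {V : Type}

/-- Ordered cyclic triangle. -/
def Tri (T : Tournament V) (a b c : V) : Prop := T.rel a b ∧ T.rel b c ∧ T.rel c a

theorem Tri.rot {T : Tournament V} {a b c : V} (h : T.Tri a b c) : T.Tri b c a :=
  ⟨h.2.1, h.2.2, h.1⟩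

theorem irr (T : Tournament V) (a : V) : ¬ T.rel a a := fun h => T.asymm a a h h

theorem ne_of_rel (T : Tournament V) {a b : V} (h : T.rel a b) : a ≠ b := by
  rintro rfl; exact T.irr a h

theorem rot_set (a b c : V) : ({a, b, c} : Set V) = {b, c, a} := by
  ext x; simp only [Set.mem_insert_iff, Set.mem_singleton_iff]; tauto

/-- Adjacency of cyclic triangles. -/
def AdjT (T : Tournament V) (C C' : Set V) : Prop :=
  T.CycTri C ∧ T.CycTri C' ∧ (C ∩ C').ncard = 2

/-- Connectivity. -/
def Conn (T : Tournament V) : Set V → Set V → Prop := Relation.ReflTransGen T.AdjT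

theorem Conn.symm {T : Tournament V} {C C' : Set V} (h : T.Conn C C') : T.Conn C' C := by
  have hs : Std.Symm T.AdjT := ⟨fun a b h => ⟨h.2.1, h.1, by rw [Set.inter_comm]; exact h.2.2⟩⟩
  induction h with
  | refl => exact Relation.ReflTransGen.refl
  | tail _ h2 ih => exact Relation.ReflTransGen.head (hs.symm _ _ h2) ih

theorem Conn.cyc {T : Tournament V} {C C' : Set V} (h : T.Conn C C') (hC : T.CycTri C) :
    T.CycTri C' := by
  induction h with
  | refl => exact hC
  | tail _ h2 _ => exact h2.2.1

theorem Conn.triConn {T : Tournament V} {C C' : Set V} (h : T.Conn C C') (hC : T.CycTri C) :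
    T.TriConn C C' := by
  induction h with
  | refl => exact ⟨0, fun _ => C, rfl, rfl, fun _ => hC, fun i => i.elim0⟩
  | @tail D E _ h2 ih =>
    obtain ⟨m, f, h0, hl, hf, hadj⟩ := ih
    refine ⟨m + 1, Fin.snoc (α := fun _ => Set V) f E, ?_, ?_, ?_, ?_⟩
    · rw [← Fin.castSucc_zero, Fin.snoc_castSucc]; exact h0
    · rw [Fin.snoc_last]
    · intro i
      refine Fin.lastCases ?_ ?_ i
      · rw [Fin.snoc_last]; exact h2.2.1
      · intro j; rw [Fin.snoc_castSucc]; exact hf j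
    · intro i
      refine Fin.lastCases ?_ ?_ i
      · rw [Fin.snoc_castSucc, Fin.succ_last, Fin.snoc_last, hl]; exact h2.2.2
      · intro j
        rw [Fin.snoc_castSucc, Fin.succ_castSucc, Fin.snoc_castSucc]; exact hadj j

theorem third {T : Tournament V} {C : Set V} (hC : T.CycTri C) {x y : V} (hx : x ∈ C)
    (hy : y ∈ C) (h : T.rel x y) : ∃ z, C = {x, y, z} ∧ T.Tri x y z := by
  obtain ⟨a, b, c, rfl, h1, h2, h3⟩ := hC
  have ha := T.asymm
  have hi := T.irr
  simp only [Set.mem_insert_iff, Set.mem_singleton_iff] at hx hy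
  rcases hx with rfl | rfl | rfl <;> rcases hy with rfl | rfl | rfl
  · exact absurd h (hi _)
  · exact ⟨c, rfl, h1, h2, h3⟩
  · exact absurd h (ha _ _ h3)
  · exact absurd h (ha _ _ h1)
  · exact absurd h (hi _)
  · exact ⟨a, by rw [rot_set], h2, h3, h1⟩
  · exact ⟨b, by rw [rot_set, rot_set], h3, h1, h2⟩
  · exact absurd h (ha _ _ h2)
  · exact absurd h (hi _)

theorem Tri.cyc {T : Tournament V} {a b c : V} (h : T.Tri a b c) : T.CycTri {a, b, c} :=
  ⟨a, b, c, rfl, h⟩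

theorem conn_edge {T : Tournament V} {a b c d : V} (h : T.Tri a b c) (h' : T.Tri a b d) :
    T.Conn {a, b, c} {a, b, d} := by
  by_cases hcd : c = d
  · subst hcd; exact Relation.ReflTransGen.refl
  · refine Relation.ReflTransGen.single ⟨h.cyc, h'.cyc, ?_⟩
    have : ({a, b, c} ∩ {a, b, d} : Set V) = {a, b} := by
      ext x
      simp only [Set.mem_inter_iff, Set.mem_insert_iff, Set.mem_singleton_iff]
      constructor
      · rintro ⟨h1 | h1 | h1, h2 | h2 | h2⟩ <;> first | exact Or.inl h1 | exact Or.inr h1 | exact Or.inl h2 | exact Or.inr h2 | exact absurd (h1.symm.trans h2) hcd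
      · tauto
    rw [this, Set.ncard_pair (T.ne_of_rel h.1)]

theorem AdjT.exists {T : Tournament V} {C C' : Set V} (h : T.AdjT C C') :
    ∃ x y z d, C = {x, y, z} ∧ C' = {x, y, d} ∧ T.Tri x y z ∧ T.Tri x y d := by
  obtain ⟨h1, h2, h3⟩ := h
  obtain ⟨x, y, hxy, he⟩ := Set.ncard_eq_two.1 h3
  have hx : x ∈ C ∩ C' := by rw [he]; simp
  have hy : y ∈ C ∩ C' := by rw [he]; simp
  rcases T.total x y hxy with h | h
  · obtain ⟨z, hz, hz'⟩ := third h1 hx.1 hy.1 h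
    obtain ⟨d, hd, hdt⟩ := third h2 hx.2 hy.2 h
    exact ⟨x, y, z, d, hz, hd, hz', hdt⟩
  · obtain ⟨z, hz, hz'⟩ := third h1 hy.1 hx.1 h
    obtain ⟨d, hd, hdt⟩ := third h2 hy.2 hx.2 h
    exact ⟨y, x, z, d, hz, hd, hz', hdt⟩

/-- Class of the triangle `C`, as a predicate on ordered triples. -/
def Cl (T : Tournament V) (C : Set V) (a b c : V) : Prop := T.Tri a b c ∧ T.Conn C {a, b, c}

theorem Cl.rot {T : Tournament V} {C : Set V} {a b c : V} (h : T.Cl C a b c) :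
    T.Cl C b c a := ⟨h.1.rot, by rw [← rot_set]; exact h.2⟩

theorem Cl.edge {T : Tournament V} {C : Set V} {a b c d : V} (h : T.Cl C a b c)
    (h' : T.Tri a b d) : T.Cl C a b d := ⟨h', h.2.trans (conn_edge h.1 h')⟩

theorem Cl.disj {T : Tournament V} {C C' : Set V} (hn : ¬ T.Conn C C') {a b c d : V}
    (h : T.Cl C a b c) (h' : T.Cl C' a b d) : False :=
  hn ((h.2.trans (conn_edge h.1 h'.1)).trans h'.2.symm)

theorem local_lemma {T : Tournament V} {C C' : Set V} (hn : ¬ T.Conn C C') {u b c w v : V}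
    (hp : T.Cl C u b c) (hq : T.Cl C' u w v) :
    (T.rel v b ∧ T.rel w b ∧ T.rel c v ∧ T.rel c w) ∨
    (T.rel v b ∧ T.rel v c ∧ T.rel b w ∧ T.rel c w) := by
  have D : ∀ {x y z d}, T.Cl C x y z → T.Cl C' x y d → False := fun h h' => Cl.disj hn h h'
  obtain ⟨ub, bc, cu⟩ := hp.1
  obtain ⟨uw, wv, vu⟩ := hq.1
  have hvb : v ≠ b := by rintro rfl; exact T.asymm _ _ ub vu
  have hwc : w ≠ c := by rintro rfl; exact T.asymm _ _ uw cu
  have hwb : w ≠ b := by rintro rfl; exact D hp hq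
  have hvc : v ≠ c := by rintro rfl; exact D hp.rot.rot hq.rot.rot
  have vb : T.rel v b := by
    refine (T.total v b hvb).resolve_right fun h => ?_
    have t : T.Tri u b v := ⟨ub, h, vu⟩
    exact D (hp.edge t).rot.rot hq.rot.rot
  have cw : T.rel c w := by
    refine (T.total c w hwc.symm).resolve_right fun h => ?_
    have t : T.Tri c u w := ⟨cu, uw, h⟩
    exact D (hp.rot.rot.edge t).rot hq
  rcases T.total w b hwb with wb | bw
  · rcases T.total v c hvc with vc | cv
    · exfalso
      have t1 : T.Tri b c w := ⟨bc, cw, wb⟩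
      have t2 : T.Tri w v c := ⟨wv, vc, cw⟩
      exact D (hp.rot.edge t1).rot (hq.rot.edge t2).rot.rot
    · exact Or.inl ⟨vb, wb, cv, cw⟩
  · rcases T.total v c hvc with vc | cv
    · exact Or.inr ⟨vb, vc, bw, cw⟩
    · exfalso
      have t1 : T.Tri b c v := ⟨bc, cv, vb⟩
      have t2 : T.Tri w v b := ⟨wv, vb, bw⟩
      exact D (hp.rot.edge t1).rot.rot (hq.rot.edge t2).rot

theorem inv_lemma {T : Tournament V} {C C' : Set V} (hn : ¬ T.Conn C C') {b c : V}
    {D : Set V} (hD : T.Conn C' D) (h0 : ∀ x ∈ D, T.Cl C x b c) {E : Set V}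
    (hE : T.Conn D E) : ∀ x ∈ E, T.Cl C x b c := by
  induction hE with
  | refl => exact h0
  | @tail F G hF hadj ih =>
    obtain ⟨x, y, z, d, rfl, rfl, h1, h2⟩ := hadj.exists
    have hx : T.Cl C x b c := ih x (by simp)
    have hy : T.Cl C y b c := ih y (by simp)
    have hq : T.Cl C' x y d := ⟨h2, (hD.trans hF).trans (conn_edge h1 h2)⟩
    have hd : T.Cl C d b c := by
      rcases local_lemma hn hx hq with ⟨h1, h2, h3, h4⟩ | ⟨h1, h2, h3, h4⟩
      · have t : T.Tri b c d := ⟨hx.1.2.1, h3, h1⟩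
        exact (hx.rot.edge t).rot.rot
      · exact absurd h3 (T.asymm _ _ hy.1.1)
    intro t ht
    simp only [Set.mem_insert_iff, Set.mem_singleton_iff] at ht
    rcases ht with rfl | rfl | rfl <;> assumption

theorem no_span {T : Tournament V} {C C' : Set V} (hn : ¬ T.Conn C C') {u b c w v : V}
    (hp : T.Cl C u b c) (hq : T.Cl C' u w v)
    (h : T.rel v b ∧ T.rel w b ∧ T.rel c v ∧ T.rel c w)
    (hspan : ∀ x, ∃ D, T.Conn C' D ∧ x ∈ D) : False := by
  obtain ⟨D, hD, hb⟩ := hspan b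
  have := inv_lemma hn hq.2 (b := b) (c := c) ?_ (hq.2.symm.trans hD) b hb
  · exact T.irr _ this.1.1
  · intro t ht
    have bc := hp.1.2.1
    simp only [Set.mem_insert_iff, Set.mem_singleton_iff] at ht
    rcases ht with rfl | rfl | rfl
    · exact hp
    · exact (hp.rot.edge (⟨bc, h.2.2.2, h.2.1⟩ : T.Tri b c t)).rot.rot
    · exact (hp.rot.edge (⟨bc, h.2.2.1, h.1⟩ : T.Tri b c t)).rot.rot

theorem exists_cl {T : Tournament V} {C D : Set V} (hC : T.CycTri C) (h : T.Conn C D) {u : V}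
    (hu : u ∈ D) : ∃ b c, T.Cl C u b c := by
  obtain ⟨x, y, z, rfl, ht⟩ := h.cyc hC
  have hc : T.Cl C x y z := ⟨ht, h⟩
  simp only [Set.mem_insert_iff, Set.mem_singleton_iff] at hu
  rcases hu with rfl | rfl | rfl
  · exact ⟨_, _, hc⟩
  · exact ⟨_, _, hc.rot⟩
  · exact ⟨_, _, hc.rot.rot⟩

theorem conn_of_span {T : Tournament V} {C C' : Set V} (hC : T.CycTri C) (hC' : T.CycTri C')
    (h : ∀ x, ∃ D, T.Conn C D ∧ x ∈ D) (h' : ∀ x, ∃ D, T.Conn C' D ∧ x ∈ D) :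
    T.Conn C C' := by
  by_contra hn
  have ⟨u, _⟩ := hC
  obtain ⟨D, hD, hu⟩ := h u
  obtain ⟨D', hD', hu'⟩ := h' u
  obtain ⟨b, c, hp⟩ := exists_cl hC hD hu
  obtain ⟨w, v, hq⟩ := exists_cl hC' hD' hu'
  rcases local_lemma hn hp hq with k | ⟨k1, k2, k3, k4⟩
  · exact no_span hn hp hq k h'
  · exact no_span (fun k => hn k.symm) hq hp ⟨k4, k3, k2, k1⟩ h

/-- Being beaten by a vertex outside all triangles of a class is constant on triangles. -/
theorem prop_tri {T : Tournament V} {C : Set V} {v : V}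
    (hv : ∀ D, T.Conn C D → v ∉ D) {a b c : V} (h : T.Cl C a b c) (ha : T.rel v a) :
    T.rel v b ∧ T.rel v c := by
  have key : ∀ {a b c : V}, T.Cl C a b c → T.rel v a → T.rel v b := by
    intro a b c h ha
    have hne : v ≠ b := by rintro rfl; exact hv _ h.2 (by simp)
    refine (T.total v b hne).resolve_right fun k => ?_
    exact hv _ (h.edge ⟨h.1.1, k, ha⟩).2 (by simp)
  exact ⟨key h ha, key h.rot (key h ha)⟩

theorem prop_set {T : Tournament V} {C : Set V} (hC : T.CycTri C) {v : V}
    (hv : ∀ D, T.Conn C D → v ∉ D) {D : Set V} (hD : T.Conn C D) {x y : V} (hx : x ∈ D)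
    (hy : y ∈ D) (h : T.rel v x) : T.rel v y := by
  by_cases hxy : x = y
  · exact hxy ▸ h
  rcases T.total x y hxy with k | k
  · obtain ⟨z, rfl, hz'⟩ := third (hD.cyc hC) hx hy k
    exact (prop_tri hv ⟨hz', hD⟩ h).1
  · obtain ⟨z, rfl, hz'⟩ := third (hD.cyc hC) hy hx k
    exact (prop_tri hv (Cl.rot ⟨hz', hD⟩) h).2

theorem prop_conn {T : Tournament V} {C : Set V} (hC : T.CycTri C) {v : V}
    (hv : ∀ D, T.Conn C D → v ∉ D) {D E : Set V} (hD : T.Conn C D) (hE : T.Conn D E) 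
    (h : ∀ x ∈ D, T.rel v x) : ∀ x ∈ E, T.rel v x := by
  induction hE with
  | refl => exact h
  | @tail F G hF hadj ih =>
    have hG : T.Conn C G := (hD.trans hF).tail hadj
    obtain ⟨x, y, z, d, rfl, rfl, h1, h2⟩ := hadj.exists
    intro t ht
    exact prop_set hC hv hG (by simp) ht (ih x (by simp))

theorem span_of_noHomog [Fintype V] {T : Tournament V}
    (hH : ¬ ∃ X : Set V, T.HomogOn Set.univ X ∧ 1 < X.ncard ∧ X.ncard < Nat.card V ∧
        ∃ C ⊆ X, T.CycTri C) {C : Set V} (hC : T.CycTri C) :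
    ∀ x, ∃ D, T.Conn C D ∧ x ∈ D := by
  by_contra! hx
  obtain ⟨x, hx⟩ := hx
  apply hH
  refine ⟨{y | ∃ D, T.Conn C D ∧ y ∈ D}, ⟨Set.subset_univ _, ?_⟩, ?_, ?_, C, ?_, hC⟩
  · rintro v ⟨-, hv⟩
    have hv' : ∀ D, T.Conn C D → v ∉ D := fun D h1 h2 => hv ⟨D, h1, h2⟩
    by_contra! hcon
    obtain ⟨⟨y, ⟨D, hD, hy⟩, hvy⟩, ⟨z, ⟨E, hE, hz⟩, hzv⟩⟩ := hcon
    have hzv' : T.rel v z := (T.total v z (by rintro rfl; exact hv' _ hE hz)).resolve_right hzv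
    exact hvy (prop_conn hC hv' hE (hE.symm.trans hD)
      (fun t ht => prop_set hC hv' hE hz ht hzv') y hy)
  · obtain ⟨a, b, c, rfl, h⟩ := hC
    rw [Set.one_lt_ncard]
    exact ⟨a, ⟨_, Relation.ReflTransGen.refl, by simp⟩, b,
      ⟨_, Relation.ReflTransGen.refl, by simp⟩, T.ne_of_rel h.1⟩
  · rw [← Set.ncard_univ]
    refine Set.ncard_lt_ncard ?_ (Set.toFinite _)
    refine (Set.ssubset_univ_iff).2 fun h => ?_
    have : x ∈ {y | ∃ D, T.Conn C D ∧ y ∈ D} := h ▸ Set.mem_univ x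
    obtain ⟨D, h1, h2⟩ := this
    exact hx D h1 h2
  · exact fun y hy => ⟨C, Relation.ReflTransGen.refl, hy⟩

theorem exists_tri {T : Tournament V} (hSC : T.StronglyConnected) {v u : V} (huv : u ≠ v) :
    ∃ a b, T.Tri v a b := by
  by_contra! hno
  rcases Relation.ReflTransGen.cases_head (hSC v u) with h | ⟨w, hw, -⟩
  · exact huv h.symm
  have : ∀ y, Relation.ReflTransGen T.rel w y → T.rel v y := by
    intro y hy
    induction hy with
    | refl => exact hw
    | @tail p q _ hpq ih =>
      have hne : v ≠ q := by rintro rfl; exact T.asymm _ _ ih hpq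
      exact (T.total v q hne).resolve_right fun h => hno p q ⟨ih, hpq, h⟩
  exact T.irr v (this v (hSC w v))

theorem homog_adj {T : Tournament V} {X : Set V} (hX : T.HomogOn Set.univ X) {C D : Set V}
    (h : T.AdjT C D) (hC : C ⊆ X) : D ⊆ X := by
  obtain ⟨x, y, z, d, rfl, rfl, h1, h2⟩ := h.exists
  have hx : x ∈ X := hC (by simp)
  have hy : y ∈ X := hC (by simp)
  have hd : d ∈ X := by
    by_contra hd
    rcases hX.2 d ⟨Set.mem_univ _, hd⟩ with k | k
    · exact T.asymm _ _ h2.2.1 (k y hy)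
    · exact T.asymm _ _ h2.2.2 (k x hx)
  intro t ht
  simp only [Set.mem_insert_iff, Set.mem_singleton_iff] at ht
  rcases ht with rfl | rfl | rfl <;> assumption

end Tournament

open Tournament

/-- A strongly connected tournament is triangle-connected if and only if it has no
nontrivial homogeneous set containing a cyclic triangle. -/
theorem stmt5 {V : Type} [Fintype V] [Nonempty V] (T : Tournament V)
    (hSC : T.StronglyConnected) :
    (∀ C C' : Set V, T.CycTri C → T.CycTri C' → T.TriConn C C') ↔
      ¬ ∃ X : Set V, T.HomogOn Set.univ X ∧ 1 < X.ncard ∧ X.ncard < Nat.card V ∧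
        ∃ C ⊆ X, T.CycTri C := by
  constructor
  · rintro hall ⟨X, hX, h1, h2, C, hCX, hC⟩
    have hne : X ≠ Set.univ := by
      rintro rfl
      rw [Set.ncard_univ] at h2
      exact lt_irrefl _ h2
    obtain ⟨v, hv⟩ := (Set.ne_univ_iff_exists_notMem X).1 hne
    obtain ⟨x, hx⟩ : X.Nonempty := Set.nonempty_of_ncard_ne_zero (by omega)
    obtain ⟨a, b, ht⟩ := exists_tri hSC (v := v) (u := x) (by rintro rfl; exact hv hx)
    obtain ⟨m, f, h0, hl, hf, hadj⟩ := hall C _ hC ht.cyc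
    have : ∀ i, f i ⊆ X := by
      intro i
      induction i using Fin.induction with
      | zero => rw [h0]; exact hCX
      | succ i ih => exact homog_adj hX ⟨hf _, hf _, hadj i⟩ ih
    have := this (Fin.last m)
    rw [hl] at this
    exact hv (this (by simp))
  · intro hH C C' hC hC'
    exact (conn_of_span hC hC' (span_of_noHomog hH hC) (span_of_noHomog hH hC')).triConn hC
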